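/- Let n ≥ 2 be an integer and τ, λ real numbers with 0 < λ < τ. In ℝ^n with standard basis e_1,…,e_n, let n_j = −e_j for j = 1,…,n, n_{n+1} = ∑_{i=1}^n e_i, n_{n+2} = e_n, and let Δ = Δ(k⁰) with k⁰ = (0,…,0, τ, λ) (the truncated simplex). If b ∈ ℤ^n and (Δ, b) is a mass linear pair with ⟨Cm(Δ(k)), b⟩ = ∑_{j=1}^{n+2} R_j k_j + C on C_Δ, then ∑_{j=1}^{n+2} R_j = 0. -/

import Mathlib

open MeasureTheory

noncomputable section

/-- Euclidean inner product on ℝⁿ. -/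
def dot {n : ℕ} (x y : Fin n → ℝ) : ℝ := ∑ i, x i * y i

/-- The polytope `Δ(k) = ⋂_j {x : ⟨x, n_j⟩ ≤ k_j}` determined by conormals `N` and
support numbers `k`. -/
def PolyDelta {n m : ℕ} (N : Fin m → Fin n → ℝ) (k : Fin m → ℝ) : Set (Fin n → ℝ) :=
  {x | ∀ j, dot x (N j) ≤ k j}

/-- The facet `F_j(k) = Δ(k) ∩ {x : ⟨x, n_j⟩ = k_j}`. -/
def PolyFacet {n m : ℕ} (N : Fin m → Fin n → ℝ) (k : Fin m → ℝ) (j : Fin m) :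
    Set (Fin n → ℝ) :=
  {x ∈ PolyDelta N k | dot x (N j) = k j}

/-- The chamber of the polytope `Δ(k⁰)`: those `k` for which the combinatorics of the
facets of `Δ(k)` agrees with that of `Δ(k⁰)`. -/
def chamber {n m : ℕ} (N : Fin m → Fin n → ℝ) (k0 : Fin m → ℝ) : Set (Fin m → ℝ) :=
  {k | ∀ J : Finset (Fin m),
    (⋂ j ∈ J, PolyFacet N k j).Nonempty ↔ (⋂ j ∈ J, PolyFacet N k0 j).Nonempty}

/-- Center of mass of a subset of ℝⁿ: `Cm(K) = (∫_K x dx)/(∫_K 1 dx)`. -/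
def Cm {n : ℕ} (K : Set (Fin n → ℝ)) : Fin n → ℝ :=
  (∫ x in K, (1 : ℝ))⁻¹ • ∫ x in K, x

/-- `(Δ(k⁰), b)` is a mass linear pair: `⟨Cm(Δ(k)), b⟩` is an (affine) linear function of
`k` on the chamber of `Δ(k⁰)`. -/
def IsMassLinear {n m : ℕ} (N : Fin m → Fin n → ℝ) (k0 : Fin m → ℝ) (b : Fin n → ℝ) :
    Prop :=
  ∃ (R : Fin m → ℝ) (C : ℝ), ∀ k ∈ chamber N k0,
    dot (Cm (PolyDelta N k)) b = (∑ j, R j * k j) + C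

/-- `Δ(k)` is a Delzant polytope: each conormal is a primitive integer vector, exactly `n`
facets meet at each vertex, and the conormals of the facets through any vertex form a
ℤ-basis of ℤⁿ (an integer matrix of determinant ±1). -/
def IsDelzant {n m : ℕ} (N : Fin m → Fin n → ℝ) (k : Fin m → ℝ) : Prop :=
  (∀ j, ∃ z : Fin n → ℤ, (∀ i, N j i = (z i : ℝ)) ∧ Finset.univ.gcd z = 1) ∧
  ∀ v ∈ Set.extremePoints ℝ (PolyDelta N k),
    ∃ J : Finset (Fin m), J.card = n ∧ (∀ j, j ∈ J ↔ dot v (N j) = k j) ∧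
      ∃ e : Fin n → Fin m, (∀ i, e i ∈ J) ∧ Function.Injective e ∧
        |(Matrix.of fun i i' => N (e i) i').det| = 1

/-- Conormals of the truncated simplex: `n_j = -e_j` for `j < n`, `n_{n+1} = ∑ e_i`,
`n_{n+2} = e_n`. -/
def truncN (n : ℕ) : Fin (n + 2) → Fin n → ℝ := fun j i =>
  if (j : ℕ) < n then (if (i : ℕ) = (j : ℕ) then -1 else 0)
  else if (j : ℕ) = n then 1
  else if (i : ℕ) = n - 1 then 1
  else 0

/-- Support numbers `k⁰ = (0,…,0,τ,λ)` of the truncated simplex. -/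
def truncK (n : ℕ) (T L : ℝ) : Fin (n + 2) → ℝ := fun j =>
  if (j : ℕ) = n then T else if (j : ℕ) = n + 1 then L else 0

/-- Support numbers `(a,…,a,c,T,d)`. -/
def kk (m : ℕ) (a c T d : ℝ) : Fin (m + 1 + 2) → ℝ := fun j =>
  if (j : ℕ) < m then a else if (j : ℕ) = m then c else if (j : ℕ) = m + 1 then T else d

lemma dot_lt (m : ℕ) (x : Fin (m+1) → ℝ) (i : Fin (m+1)) :
    dot x (truncN (m+1) i.castSucc.castSucc) = - x i := by
  unfold dot truncN
  rw [Finset.sum_eq_single i]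
  · have hi : (i : ℕ) < m + 1 := i.2
    simp [hi]
  · intro j _ hj
    have : (j : ℕ) ≠ i := fun h => hj (Fin.ext h)
    have hi : (i : ℕ) < m + 1 := i.2
    simp [this, hi]
  · simp

lemma dot_n (m : ℕ) (x : Fin (m+1) → ℝ) :
    dot x (truncN (m+1) (Fin.last (m+1)).castSucc) = ∑ i, x i := by
  unfold dot truncN
  simp

lemma dot_n1 (m : ℕ) (x : Fin (m+1) → ℝ) :
    dot x (truncN (m+1) (Fin.last (m+2))) = x (Fin.last m) := by
  unfold dot truncN
  rw [Finset.sum_eq_single (Fin.last m)]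
  · simp
  · intro j _ hj
    have : (j : ℕ) ≠ m := fun h => hj (Fin.ext h)
    simp [this]
  · simp

lemma mem_P (m : ℕ) (a c T d : ℝ) (x : Fin (m+1) → ℝ) :
    x ∈ PolyDelta (truncN (m+1)) (kk m a c T d) ↔
      (∀ i : Fin m, -a ≤ x i.castSucc) ∧ -c ≤ x (Fin.last m) ∧ ∑ i, x i ≤ T ∧
        x (Fin.last m) ≤ d := by
  unfold PolyDelta
  rw [Set.mem_ofPred_eq, Fin.forall_fin_succ', Fin.forall_fin_succ', Fin.forall_fin_succ']
  have h1 : ∀ i : Fin m, kk m a c T d i.castSucc.castSucc.castSucc = a := by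
    intro i; simp [kk]
  simp only [dot_lt, dot_n, dot_n1, h1]
  simp only [kk, Fin.val_castSucc, Fin.val_last]
  simp [neg_le, and_assoc]

lemma facets_iff (m : ℕ) (a c T d : ℝ) (h1 : -c < d) (h2 : d < m * a + T)
    (J : Finset (Fin (m+1+2))) :
    (⋂ j ∈ J, PolyFacet (truncN (m+1)) (kk m a c T d) j).Nonempty ↔
     ¬ ((Fin.last m).castSucc.castSucc ∈ J ∧ Fin.last (m+2) ∈ J) ∧
     ¬ ((∀ i : Fin m, i.castSucc.castSucc.castSucc ∈ J) ∧ (Fin.last (m+1)).castSucc ∈ J) := by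
  have e1 : ∀ i : Fin m, kk m a c T d i.castSucc.castSucc.castSucc = a := by
    intro i; simp [kk]
  have e2 : kk m a c T d (Fin.last m).castSucc.castSucc = c := by simp [kk]
  have e3 : kk m a c T d (Fin.last (m+1)).castSucc = T := by simp [kk]
  have e4 : kk m a c T d (Fin.last (m+2)) = d := by simp [kk]
  constructor
  · rintro ⟨x, hx⟩
    simp only [Set.mem_iInter] at hx
    constructor
    · rintro ⟨ha, hb⟩
      have q1 := (hx _ ha).2
      have q2 := (hx _ hb).2
      rw [dot_lt, e2] at q1
      rw [dot_n1, e4] at q2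
      linarith
    · rintro ⟨ha, hb⟩
      have q2 := (hx _ hb).2
      have q3 := ((mem_P m a c T d x).1 (hx _ hb).1).2.2.2
      rw [dot_n, e3, Fin.sum_univ_castSucc] at q2
      have : ∀ i : Fin m, x i.castSucc = -a := by
        intro i
        have q1 := (hx _ (ha i)).2
        rw [dot_lt, e1] at q1
        linarith
      simp [this] at q2
      linarith
  · rintro ⟨ha, hb⟩
    obtain ⟨y, hy1, hy2, hy3, hy4⟩ : ∃ y : ℝ, -c ≤ y ∧ y ≤ d ∧
        ((Fin.last m).castSucc.castSucc ∈ J → -y = c) ∧ (Fin.last (m+2) ∈ J → y = d) := by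
      by_cases h : Fin.last (m+2) ∈ J
      · exact ⟨d, h1.le, le_rfl, fun h' => (ha ⟨h', h⟩).elim, fun _ => rfl⟩
      · exact ⟨-c, le_rfl, h1.le, fun _ => by ring, fun h' => (h h').elim⟩
    obtain ⟨z, hz1, hz2, hz3, hz4⟩ : ∃ z : Fin m → ℝ, (∀ i, -a ≤ z i) ∧ ∑ i, z i + y ≤ T ∧
        (∀ i : Fin m, i.castSucc.castSucc.castSucc ∈ J → z i = -a) ∧
        ((Fin.last (m+1)).castSucc ∈ J → ∑ i, z i + y = T) := by
      by_cases h : (Fin.last (m+1)).castSucc ∈ J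
      · have : ∃ i : Fin m, i.castSucc.castSucc.castSucc ∉ J := by
          by_contra hcon
          push Not at hcon
          exact hb ⟨hcon, h⟩
        obtain ⟨p, hp⟩ := this
        have hs : ∑ i, (-a + if i = p then m * a + T - y else 0) + y = T := by
          rw [Finset.sum_add_distrib]
          simp
          ring
        refine ⟨fun i => -a + if i = p then m * a + T - y else 0, ?_, hs.le, ?_, fun _ => hs⟩
        · intro i
          dsimp only
          split_ifs <;> linarith
        · intro i hi
          have : i ≠ p := by rintro rfl; exact hp hi
          simp [this]
      · refine ⟨fun _ => -a, fun _ => le_rfl, ?_, fun _ _ => rfl, fun h' => (h h').elim⟩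
        simp
        linarith
    refine ⟨Fin.snoc z y, ?_⟩
    have hP : (Fin.snoc z y : Fin (m+1) → ℝ) ∈ PolyDelta (truncN (m+1)) (kk m a c T d) := by
      rw [mem_P]
      simp only [Fin.sum_univ_castSucc, Fin.snoc_castSucc, Fin.snoc_last]
      exact ⟨hz1, hy1, hz2, hy2⟩
    simp only [Set.mem_iInter]
    intro j hj
    refine ⟨hP, ?_⟩
    induction j using Fin.lastCases with
    | last => rw [dot_n1, e4, Fin.snoc_last]; exact hy4 hj
    | cast j =>
      induction j using Fin.lastCases with
      | last => 
        rw [dot_n, e3]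
        simp only [Fin.sum_univ_castSucc, Fin.snoc_castSucc, Fin.snoc_last]
        exact hz4 hj
      | cast j =>
        rw [dot_lt]
        induction j using Fin.lastCases with
        | last => rw [e2, Fin.snoc_last]; exact hy3 hj
        | cast j => rw [e1, Fin.snoc_castSucc, hz3 j hj]; ring

lemma truncK_eq (m : ℕ) (T L : ℝ) : truncK (m+1) T L = kk m 0 0 T L := by
  funext j
  unfold truncK kk
  have := j.2
  split_ifs <;> first | rfl | omega

lemma kk_mem (m : ℕ) (T L : ℝ) (hL : 0 < L) (hLT : L < T) (t e : ℝ) (he : 0 < e) (het : e < t) :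
    kk m t e t e ∈ chamber (truncN (m+1)) (truncK (m+1) T L) := by
  intro J
  have : 0 ≤ (m : ℝ) * t := by have : 0 < t := by linarith
                               positivity
  rw [truncK_eq, facets_iff m t e t e (by linarith) (by linarith),
    facets_iff m 0 0 T L (by linarith) (by linarith)]

lemma refl_int {n : ℕ} (f : (Fin n → ℝ) →ₗ[ℝ] (Fin n → ℝ)) (hf : ∀ x, f (f x) = x)
    (S : Set (Fin n → ℝ)) (hS : ∀ x ∈ S, f x ∈ S) (g : (Fin n → ℝ) → ℝ) :
    ∫ x in S, g (f x) = ∫ x in S, g x := by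
  have hc : Continuous f := f.continuous_of_finiteDimensional
  have hcomp : f ∘ₗ f = LinearMap.id := LinearMap.ext hf
  have hd : LinearMap.det f * LinearMap.det f = 1 := by
    rw [← LinearMap.det_comp, hcomp, LinearMap.det_id]
  have hd0 : LinearMap.det f ≠ 0 := by
    intro h; simp [h] at hd
  have habs : |(LinearMap.det f)⁻¹| = 1 := by
    rcases mul_self_eq_one_iff.1 hd with h | h <;> simp [h]
  have hmp : MeasurePreserving f volume volume := by
    refine ⟨hc.measurable, ?_⟩
    rw [Measure.map_linearMap_addHaar_eq_smul_addHaar volume hd0, habs]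
    simp
  let h : (Fin n → ℝ) ≃ₜ (Fin n → ℝ) :=
    { toFun := f, invFun := f, left_inv := hf, right_inv := hf,
      continuous_toFun := hc, continuous_invFun := hc }
  have hemb : MeasurableEmbedding f := h.measurableEmbedding
  have hpre : f ⁻¹' S = S := by
    ext x
    exact ⟨fun hx => by have := hS _ hx; rwa [hf] at this, hS x⟩
  have := hmp.setIntegral_preimage_emb hemb g S
  rwa [hpre] at this

lemma P_compact (m : ℕ) (t e : ℝ) (het : e < t) :
    IsCompact (PolyDelta (truncN (m+1)) (kk m t e t e)) := by
  have hcl : IsClosed (PolyDelta (truncN (m+1)) (kk m t e t e)) := by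
    unfold PolyDelta dot
    simp only [Set.ofPred_forall]
    refine isClosed_iInter fun j => isClosed_le (by fun_prop) (by fun_prop)
  refine (isCompact_Icc (a := fun _ : Fin (m+1) => -t)
    (b := fun _ => t + (m+1) * t)).of_isClosed_subset hcl ?_
  intro x hx
  rw [mem_P] at hx
  obtain ⟨h1, h2, h3, h4⟩ := hx
  have hlow : ∀ j, -t ≤ x j := by
    intro j
    induction j using Fin.lastCases with
    | last => linarith
    | cast j => exact h1 j
  refine ⟨fun j => hlow j, fun j => ?_⟩
  have := Finset.single_le_sum (f := fun j => x j + t) (s := Finset.univ)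
    (fun i _ => by have := hlow i; linarith) (Finset.mem_univ j)
  rw [Finset.sum_add_distrib] at this
  simp at this
  have ht : 0 ≤ x j + t := by linarith [hlow j]
  by_cases hj : 0 ≤ t
  · show x j ≤ t + (m+1) * t
    linarith
  · show x j ≤ t + (m+1) * t
    linarith

lemma Cm_apply {n : ℕ} (K : Set (Fin n → ℝ)) (hK : IsCompact K) (i : Fin n) :
    Cm K i = (volume.real K)⁻¹ * ∫ x in K, x i := by
  have hi : IntegrableOn (fun x : Fin n → ℝ => x) K volume :=
    continuous_id.continuousOn.integrableOn_compact hK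
  have := (ContinuousLinearMap.proj (R := ℝ) (φ := fun _ : Fin n => ℝ) i).integral_comp_comm hi
  simp only [ContinuousLinearMap.proj_apply] at this
  unfold Cm
  rw [this]
  simp

lemma int_apply (m : ℕ) (t e : ℝ) (het : e < t) (i : Fin m) :
    ∫ x in PolyDelta (truncN (m+1)) (kk m t e t e), x i.castSucc =
      - ∑ j, ∫ x in PolyDelta (truncN (m+1)) (kk m t e t e), x j := by
  have hK := P_compact m t e het
  rw [← integral_finsetSum, ← integral_neg]
  swap
  · intro j _
    exact (continuous_apply j).continuousOn.integrableOn_compact hK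
  let f : (Fin (m+1) → ℝ) →ₗ[ℝ] (Fin (m+1) → ℝ) :=
    { toFun := fun x => Function.update x i.castSucc (-∑ j, x j)
      map_add' := by
        intro x y
        ext j
        by_cases h : j = i.castSucc
        · subst h; simp [Finset.sum_add_distrib]; ring
        · simp [h]
      map_smul' := by
        intro r x
        ext j
        by_cases h : j = i.castSucc
        · subst h; simp [Finset.mul_sum]
        · simp [h] }
  have f1 : ∀ x, f x i.castSucc = -∑ j, x j := fun x => by simp [f]
  have f2 : ∀ x j, j ≠ i.castSucc → f x j = x j := fun x j h => by simp [f, h]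
  have f3 : ∀ x, ∑ j, f x j = - x i.castSucc := by
    intro x
    have a1 := Finset.sum_erase_add Finset.univ (f x) (Finset.mem_univ i.castSucc)
    have a2 := Finset.sum_erase_add Finset.univ x (Finset.mem_univ i.castSucc)
    have a3 : ∑ j ∈ Finset.univ.erase i.castSucc, f x j =
        ∑ j ∈ Finset.univ.erase i.castSucc, x j :=
      Finset.sum_congr rfl fun j hj => f2 x j (Finset.ne_of_mem_erase hj)
    rw [f1] at a1
    linarith
  have hff : ∀ x, f (f x) = x := by
    intro x
    ext j
    by_cases h : j = i.castSucc
    · subst h; rw [f1, f3]; ring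
    · rw [f2 _ _ h, f2 _ _ h]
  have hlast : Fin.last m ≠ i.castSucc := (Fin.castSucc_lt_last i).ne'
  rw [← refl_int f hff _ _ (fun x => x i.castSucc)]
  · simp only [f1]
  · intro x hx
    rw [mem_P] at hx ⊢
    obtain ⟨h1, h2, h3, h4⟩ := hx
    rw [f2 _ _ hlast, f3]
    refine ⟨?_, h2, by linarith [h1 i], h4⟩
    intro j
    by_cases h : j = i
    · subst h; rw [f1]; linarith
    · rw [f2 _ _ (by simpa using h)]; exact h1 j

open scoped Pointwise in
lemma ybound (m : ℕ) (t e : ℝ) (he : 0 < e) (het : e < t) :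
    |Cm (PolyDelta (truncN (m+1)) (kk m t e t e)) (Fin.last m)| ≤
      e * (((t+e)/(t-e))^(m+1) - 1) := by
  have hK := P_compact m t e het
  rw [Cm_apply _ hK]
  set P := PolyDelta (truncN (m+1)) (kk m t e t e) with hP
  let I : Set (Fin (m+1) → ℝ) := {x | (∀ i : Fin m, -t ≤ x i.castSucc) ∧
    -e ≤ x (Fin.last m) ∧ x (Fin.last m) ≤ e ∧ ∑ i : Fin m, x i.castSucc ≤ t - e}
  have hIP : I ⊆ P := by
    rintro x ⟨h1, h2, h3, h4⟩
    rw [hP, mem_P, Fin.sum_univ_castSucc]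
    exact ⟨h1, h2, by linarith, h3⟩
  have hIcl : IsClosed I := by
    simp only [I, Set.ofPred_and, Set.ofPred_forall]
    refine (isClosed_iInter fun j => isClosed_le (by fun_prop) (by fun_prop)).inter
      ((isClosed_le (by fun_prop) (by fun_prop)).inter
      ((isClosed_le (by fun_prop) (by fun_prop)).inter
      (isClosed_le (by fun_prop) (by fun_prop))))
  have hIc : IsCompact I := hK.of_isClosed_subset hIcl hIP
  set c := (t+e)/(t-e) with hc
  have hte : 0 < t - e := by linarith
  have hc1 : 1 ≤ c := by rw [hc, le_div_iff₀ hte]; linarith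
  have hc0 : 0 < c := by linarith
  have hsub : P ⊆ c • I := by
    intro x hx
    rw [hP, mem_P, Fin.sum_univ_castSucc] at hx
    obtain ⟨h1, h2, h3, h4⟩ := hx
    rw [Set.mem_smul_set_iff_inv_smul_mem₀ hc0.ne']
    have key : ∀ s y : ℝ, 0 ≤ s → -s ≤ y → -s ≤ c⁻¹ * y := by
      intro s y hs hy
      rw [inv_mul_eq_div, le_div_iff₀ hc0]
      nlinarith
    refine ⟨fun i => key t _ (by linarith) (h1 i), key e _ he.le h2, ?_, ?_⟩
    · have := key e (- x (Fin.last m)) he.le (by linarith)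
      simp only [Pi.smul_apply, smul_eq_mul]
      linarith
    · simp only [Pi.smul_apply, smul_eq_mul, ← Finset.mul_sum]
      rw [inv_mul_eq_div, div_le_iff₀ hc0, hc, mul_div_cancel₀ _ hte.ne']
      linarith
  have hvol : volume.real P ≤ c^(m+1) * volume.real I := by
    have h1 : volume.real P ≤ volume.real (c • I) :=
      measureReal_mono hsub (hIc.smul c).measure_lt_top.ne
    rw [Measure.real, Measure.real, Measure.addHaar_smul, ENNReal.toReal_mul,
      ENNReal.toReal_ofReal (abs_nonneg _)] at h1
    simpa [abs_of_pos hc0, Measure.real] using h1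
  have hI0 : ∫ x in I, x (Fin.last m) = 0 := by
    let f : (Fin (m+1) → ℝ) →ₗ[ℝ] (Fin (m+1) → ℝ) :=
      { toFun := fun x => Function.update x (Fin.last m) (- x (Fin.last m))
        map_add' := by
          intro x y
          ext j
          by_cases h : j = Fin.last m
          · subst h; simp; ring
          · simp [h]
        map_smul' := by
          intro r x
          ext j
          by_cases h : j = Fin.last m
          · subst h; simp
          · simp [h] }
    have f1 : ∀ x, f x (Fin.last m) = - x (Fin.last m) := fun x => by simp [f]
    have f2 : ∀ x j, j ≠ Fin.last m → f x j = x j := fun x j h => by simp [f, h]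
    have f2' : ∀ x (j : Fin m), f x j.castSucc = x j.castSucc := fun x j =>
      f2 x _ (Fin.castSucc_lt_last j).ne
    have hff : ∀ x, f (f x) = x := by
      intro x
      ext j
      by_cases h : j = Fin.last m
      · subst h; rw [f1, f1]; ring
      · rw [f2 _ _ h, f2 _ _ h]
    have := refl_int f hff I (by
      rintro x ⟨h1, h2, h3, h4⟩
      refine ⟨?_, ?_, ?_, ?_⟩
      · intro i; rw [f2']; exact h1 i
      · rw [f1]; linarith
      · rw [f1]; linarith
      · simp only [f2']; exact h4) (fun x => x (Fin.last m))
    simp only [f1, integral_neg] at this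
    linarith
  have hint : IntegrableOn (fun x : Fin (m+1) → ℝ => x (Fin.last m)) P volume :=
    (continuous_apply _).continuousOn.integrableOn_compact hK
  have hdiff := setIntegral_sdiff hIcl.measurableSet hint hIP
  rw [hI0, sub_zero] at hdiff
  have hb : |∫ x in P, x (Fin.last m)| ≤ e * volume.real (P \ I) := by
    rw [← hdiff, ← Real.norm_eq_abs]
    refine norm_setIntegral_le_of_norm_le_const
      ((measure_mono Set.sdiff_subset).trans_lt hK.measure_lt_top) ?_
    rintro x ⟨hx, -⟩
    rw [hP, mem_P] at hx
    rw [Real.norm_eq_abs, abs_le]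
    exact ⟨hx.2.1, hx.2.2.2⟩
  rw [measureReal_sdiff hIP hIcl.measurableSet hK.measure_lt_top.ne] at hb
  have hVI : volume.real I ≤ volume.real P := measureReal_mono hIP hK.measure_lt_top.ne
  have hc2 : 1 ≤ c^(m+1) := one_le_pow₀ hc1
  have hV0 : 0 ≤ volume.real P := measureReal_nonneg
  rw [abs_mul, abs_of_nonneg (inv_nonneg.2 hV0)]
  have h5 : |∫ x in P, x (Fin.last m)| ≤ volume.real P * (e * (c^(m+1) - 1)) := by
    refine hb.trans ?_
    have : volume.real P - volume.real I ≤ (c^(m+1) - 1) * volume.real P := by nlinarith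
    nlinarith
  have h6 : 0 ≤ e * (c^(m+1) - 1) := mul_nonneg he.le (by linarith)
  rcases hV0.eq_or_lt with h | h
  · rw [← h]; simpa using h6
  · rw [inv_mul_le_iff₀ h]; exact h5

lemma lim_c (m : ℕ) (t : ℝ) (ht : 0 < t) :
    Filter.Tendsto (fun e : ℝ => ((t+e)/(t-e))^(m+1) - 1) (nhdsWithin 0 (Set.Ioi 0)) (nhds 0) := by
  have : ContinuousAt (fun e : ℝ => ((t+e)/(t-e))^(m+1) - 1) 0 := by
    have : t - 0 ≠ 0 := by simpa using ht.ne'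
    fun_prop (disch := assumption)
  have h := this.tendsto
  simp [ht.ne'] at h
  exact h.mono_left nhdsWithin_le_nhds

lemma lim_arg (m : ℕ) (t : ℝ) (ht : 0 < t) (D α S : ℝ) (y : ℝ → ℝ)
    (hy : ∀ e, 0 < e → e < t → |y e| ≤ e * (((t+e)/(t-e))^(m+1) - 1))
    (h : ∀ e, 0 < e → e < t → D * y e = α + S * e) : α = 0 ∧ S = 0 := by
  have hev : ∀ᶠ e in nhdsWithin (0:ℝ) (Set.Ioi 0), 0 < e ∧ e < t := Ioo_mem_nhdsGT ht
  have hid : Filter.Tendsto (fun e : ℝ => e) (nhdsWithin (0:ℝ) (Set.Ioi 0)) (nhds 0) :=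
    nhdsWithin_le_nhds
  have hl := lim_c m t ht
  have hbd : ∀ e, 0 < e → e < t → |α + S * e| ≤ |D| * (e * (((t+e)/(t-e))^(m+1) - 1)) := by
    intro e h1 h2
    rw [← h e h1 h2, abs_mul]
    exact mul_le_mul_of_nonneg_left (hy e h1 h2) (abs_nonneg _)
  have hα : α = 0 := by
    have l1 : Filter.Tendsto (fun e : ℝ => |α + S * e|) (nhdsWithin (0:ℝ) (Set.Ioi 0))
        (nhds |α + S * 0|) := ((hid.const_mul S).const_add α).abs
    have l2 := (hid.mul hl).const_mul |D|
    have := le_of_tendsto_of_tendsto l1 l2 (hev.mono fun e he => hbd e he.1 he.2)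
    simpa using this
  refine ⟨hα, ?_⟩
  subst hα
  have l2 := hl.const_mul |D|
  have : |S| ≤ |D| * 0 := by
    refine ge_of_tendsto l2 (hev.mono fun e he => ?_)
    have := hbd e he.1 he.2
    rw [zero_add, abs_mul, abs_of_pos he.1] at this
    refine le_of_mul_le_mul_right ?_ he.1
    linarith
  simpa using this

theorem stmt19 (n : ℕ) (hn : 2 ≤ n) (T L : ℝ) (hL : 0 < L) (hLT : L < T)
    (b : Fin n → ℤ) (R : Fin (n + 2) → ℝ) (C : ℝ)
    (hml : ∀ k ∈ chamber (truncN n) (truncK n T L),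
      dot (Cm (PolyDelta (truncN n) k)) (fun i => (b i : ℝ)) = (∑ j, R j * k j) + C) :
    (∑ j, R j) = 0 := by
  obtain ⟨m, rfl⟩ : ∃ m, n = m + 1 := ⟨n - 1, by omega⟩
  set Q := ∑ i : Fin m, R i.castSucc.castSucc.castSucc with hQ
  set r1 := R (Fin.last m).castSucc.castSucc with hr1
  set r2 := R (Fin.last (m+1)).castSucc with hr2
  set r3 := R (Fin.last (m+2)) with hr3
  have hsum : ∑ j, R j = Q + r1 + r2 + r3 := by
    rw [Fin.sum_univ_castSucc, Fin.sum_univ_castSucc, Fin.sum_univ_castSucc]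
  set B : ℝ := ∑ i : Fin m, (b i.castSucc : ℝ) with hB
  have main : ∀ t e, 0 < e → e < t →
      ((b (Fin.last m) : ℝ) - B / (m+1)) *
        Cm (PolyDelta (truncN (m+1)) (kk m t e t e)) (Fin.last m) =
      (t * (Q + r2) + C) + (r1 + r3) * e := by
    intro t e he het
    have h := hml _ (kk_mem m T L hL hLT t e he het)
    have hR : ∑ j, R j * kk m t e t e j = t * (Q + r2) + (r1 + r3) * e := by
      have e1 : ∀ i : Fin m, kk m t e t e i.castSucc.castSucc.castSucc = t := by
        intro i; simp [kk]
      have e2 : kk m t e t e (Fin.last m).castSucc.castSucc = e := by simp [kk]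
      have e3 : kk m t e t e (Fin.last (m+1)).castSucc = t := by simp [kk]
      have e4 : kk m t e t e (Fin.last (m+2)) = e := by simp [kk]
      rw [Fin.sum_univ_castSucc, Fin.sum_univ_castSucc, Fin.sum_univ_castSucc]
      simp only [e1, e2, e3, e4, ← Finset.sum_mul]
      ring
    rw [hR] at h
    have hK := P_compact m t e het
    set X := Cm (PolyDelta (truncN (m+1)) (kk m t e t e)) with hX
    have hXi : ∀ i : Fin m, X i.castSucc = - ∑ j, X j := by
      intro i
      simp only [hX, Cm_apply _ hK, ← Finset.mul_sum]
      rw [int_apply m t e het i]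
      ring
    set σ := - ∑ j, X j with hσ
    have hs : (m + 1) * σ = - X (Fin.last m) := by
      have : σ = -(m * σ + X (Fin.last m)) := by
        conv_lhs => rw [hσ, Fin.sum_univ_castSucc]
        simp only [hXi]
        simp
      linarith
    unfold dot at h
    rw [Fin.sum_univ_castSucc] at h
    simp only [hXi, ← Finset.mul_sum] at h
    rw [← hB] at h
    have hm : (m + 1 : ℝ) ≠ 0 := by positivity
    have hσ2 : σ = - X (Fin.last m) / (m+1) := by
      rw [eq_div_iff hm]; linarith
    rw [hσ2] at h
    rw [show t * (Q + r2) + C + (r1 + r3) * e = t * (Q + r2) + (r1 + r3) * e + C by ring, ← h]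
    ring
  have h1 := lim_arg m 1 one_pos _ _ _ _ (fun e => ybound m 1 e) (main 1)
  have h2 := lim_arg m 2 two_pos _ _ _ _ (fun e => ybound m 2 e) (main 2)
  rw [hsum]
  linarith [h1.1, h1.2, h2.1]
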